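/- For any rooted Kripke frame F, every propositional modal formula valid on the n-frame N_ω(F) is valid on F: Log(N_ω(F)) ⊆ Log(F). -/

import Mathlib

open Classical

noncomputable section

/- ### Propositional modal formulas -/

/-- Propositional modal formulas: `⊥`, letters, `→`, `□`. -/
inductive MF : Type
  | falsum : MF
  | prop : ℕ → MF
  | impl : MF → MF → MF
  | box : MF → MF

def negMF (A : MF) : MF := .impl A .falsum
def diaMF (A : MF) : MF := negMF (.box (negMF A))

/-- `□^k A`. -/
def boxIter : ℕ → MF → MF
  | 0, A => A
  | k+1, A => boxIter k (.box A)

/-- the one-way PTC axiom `□p → □^k p`. -/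
def ptcAxiom (k : ℕ) : MF := .impl (.box (.prop 0)) (boxIter k (.prop 0))

/-- a formula is closed if it contains no propositional letters. -/
def ClosedMF : MF → Prop
  | .falsum => True
  | .prop _ => False
  | .impl A B => ClosedMF A ∧ ClosedMF B
  | .box A => ClosedMF A

/- ### Kripke semantics -/

def ksat {W : Type} (R : W → W → Prop) (V : ℕ → Set W) : W → MF → Prop
  | _, .falsum => False
  | x, .prop n => x ∈ V n
  | x, .impl A B => ksat R V x A → ksat R V x B
  | x, .box A => ∀ y, R x y → ksat R V y A

/-- the logic of a Kripke frame: all formulas valid on it. -/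
def KLog {W : Type} (R : W → W → Prop) : Set MF := {A | ∀ V x, ksat R V x A}

/-- p-morphism of Kripke frames. -/
def IsPMorphismK {W U : Type} (R : W → W → Prop) (S : U → U → Prop) (f : W → U) : Prop :=
  Function.Surjective f ∧
  (∀ w v, R w v → S (f w) (f v)) ∧
  (∀ w u', S (f w) u' → ∃ v, R w v ∧ f v = u')

/- ### Neighbourhood semantics -/

def nbsat {X : Type} (τ : X → Filter X) (V : ℕ → Set X) : X → MF → Prop
  | _, .falsum => False
  | x, .prop n => x ∈ V n
  | x, .impl A B => nbsat τ V x A → nbsat τ V x B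
  | x, .box A => ∃ U ∈ τ x, ∀ y ∈ U, nbsat τ V y A

def NLog {X : Type} (τ : X → Filter X) : Set MF := {A | ∀ V x, nbsat τ V x A}

/-- the neighbourhood frame `N(F)` of a Kripke frame: the filter of supersets of `R(w)`. -/
def nbhdOf {W : Type} (R : W → W → Prop) : W → Filter W :=
  fun w => Filter.principal {u | R w u}

/-- p-morphism of neighbourhood frames. -/
def IsPMorphismN {X Y : Type} (τ : X → Filter X) (σ : Y → Filter Y) (f : X → Y) : Prop :=
  Function.Surjective f ∧
  (∀ x, ∀ U ∈ τ x, f '' U ∈ σ (f x)) ∧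
  (∀ x, ∀ V ∈ σ (f x), f ⁻¹' V ∈ τ x)

/- ### Rootedness and unravelling -/

/-- every point is reachable from `w0`. -/
def IsRootedAt {W : Type} (R : W → W → Prop) (w0 : W) : Prop :=
  ∀ w, Relation.ReflTransGen R w0 w

/-- the set of rooted paths of `(W, R)` with root `w0`. -/
def Unravel (W : Type) (R : W → W → Prop) (w0 : W) : Type :=
  {l : List W // l.head? = some w0 ∧ l.Chain' R}

/-- `π` : the last point of a rooted path. -/
def Unravel.last {W : Type} {R : W → W → Prop} {w0 : W} (p : Unravel W R w0) : W :=
  p.1.getLast (fun h => by have h1 := p.2.1; rw [h] at h1; simp at h1)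

/-- the relation `R^♯` of the unravelling: one-step extension of paths. -/
def RSharp {W : Type} (R : W → W → Prop) (w0 : W) (p q : Unravel W R w0) : Prop :=
  ∃ v, q.1 = p.1 ++ [v] ∧ R p.last v

/- ### Pseudo-infinite paths with stops -/

/-- `st(α)`: the length of the prefix before the infinite tail of zeros. -/
def stOf {A : Type} (α : ℕ → Option A) : ℕ :=
  sInf {m | ∀ k, m ≤ k → α k = none}

/-- the zero-free part of an eventually-zero sequence. -/
def zf {A : Type} (α : ℕ → Option A) : List A :=
  (List.range (stOf α)).filterMap α

/-- `W_ω`: pseudo-infinite paths with stops (zeros encoded as `none`). -/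
def Wom (W : Type) (R : W → W → Prop) (w0 : W) : Type :=
  {α : ℕ → Option W //
    (∃ m, ∀ k, m ≤ k → α k = none) ∧ (w0 :: zf α).Chain' R}

/-- `f₀` maps a pseudo-infinite path to its zero-free rooted path. -/
def fzero {W : Type} {R : W → W → Prop} {w0 : W} (α : Wom W R w0) : Unravel W R w0 :=
  ⟨w0 :: zf α.1, rfl, α.2.2⟩

/-- the basic neighbourhoods `U_k(α)`. -/
def Uk {W : Type} {R : W → W → Prop} {w0 : W} (k : ℕ) (α : Wom W R w0) :
    Set (Wom W R w0) :=
  {β | (∀ i, i < max k (stOf α.1) → α.1 i = β.1 i) ∧ RSharp R w0 (fzero α) (fzero β)}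

/-- the neighbourhood function of `N_ω(F)`: the filter generated by `{U_n(α) : n ∈ ℕ}`. -/
def tauOm {W : Type} (R : W → W → Prop) (w0 : W) (α : Wom W R w0) :
    Filter (Wom W R w0) :=
  ⨅ n : ℕ, Filter.principal (Uk n α)

/- ### Entanglement -/

def leftW {W1 W2 : Type} (l : List (W1 ⊕ W2)) : List W1 :=
  l.filterMap (Sum.elim some fun _ => none)

def rightW {W1 W2 : Type} (l : List (W1 ⊕ W2)) : List W2 :=
  l.filterMap (Sum.elim (fun _ => none) some)

/-- the entanglement `F₁ ⋈ F₂`: words whose two projections (with roots prefixed)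
are rooted paths. -/
def Ent {W1 W2 : Type} (R1 : W1 → W1 → Prop) (x0 : W1)
    (R2 : W2 → W2 → Prop) (y0 : W2) : Set (List (W1 ⊕ W2)) :=
  {x | (x0 :: leftW x).Chain' R1 ∧ (y0 :: rightW x).Chain' R2}

/-- `x ∼ y` iff `x = t·c`, `y = t·d` with `t` in the entanglement, `c, d ∈ W₁*`. -/
def SimRel {W1 W2 : Type} (R1 : W1 → W1 → Prop) (x0 : W1)
    (R2 : W2 → W2 → Prop) (y0 : W2) (x y : List (W1 ⊕ W2)) : Prop :=
  ∃ t ∈ Ent R1 x0 R2 y0, ∃ c d : List W1,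
    x = t ++ c.map Sum.inl ∧ y = t ++ d.map Sum.inl

/-- the `∼`-class `[x]` (within the entanglement). -/
def simCls {W1 W2 : Type} (R1 : W1 → W1 → Prop) (x0 : W1)
    (R2 : W2 → W2 → Prop) (y0 : W2) (x : List (W1 ⊕ W2)) : Set (List (W1 ⊕ W2)) :=
  {y | y ∈ Ent R1 x0 R2 y0 ∧ SimRel R1 x0 R2 y0 x y}

/-- `D'_a`: elements of the entanglement whose first projection is `a`. -/
def Dprime {W1 W2 : Type} (R1 : W1 → W1 → Prop) (x0 : W1)
    (R2 : W2 → W2 → Prop) (y0 : W2) (a : Unravel W1 R1 x0) : Set (List (W1 ⊕ W2)) :=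
  {x | x ∈ Ent R1 x0 R2 y0 ∧ x0 :: leftW x = a.1}

/-- `D^♯_a = {[x] : x ∈ D'_a}`. -/
def Dsharp {W1 W2 : Type} (R1 : W1 → W1 → Prop) (x0 : W1)
    (R2 : W2 → W2 → Prop) (y0 : W2) (a : Unravel W1 R1 x0) :
    Set (Set (List (W1 ⊕ W2))) :=
  {S | ∃ x ∈ Dprime R1 x0 R2 y0 a, S = simCls R1 x0 R2 y0 x}

/-- `ℝ ∖ {0}`. -/
def Rnz : Type := {r : ℝ // r ≠ 0}

def y0R : Rnz := ⟨1, one_ne_zero⟩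

/-- the total relation on `ℝ ∖ {0}` (the continuum S5 frame). -/
def TotR : Rnz → Rnz → Prop := fun _ _ => True

/- ### Predicate modal formulas and semantics -/

/-- Modal predicate formulas; `pred k n args` is the `k`-th `n`-ary predicate letter
applied to the variables `args`; variables are named by natural numbers. -/
inductive PF : Type
  | falsum : PF
  | pred : ℕ → (n : ℕ) → (Fin n → ℕ) → PF
  | impl : PF → PF → PF
  | box : PF → PF
  | all : ℕ → PF → PF

def negPF (A : PF) : PF := .impl A .falsum
def exPF (x : ℕ) (A : PF) : PF := negPF (.all x (negPF A))

/-- satisfaction in a predicate Kripke model with expanding domains,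
relative to an assignment `env` of elements to variables. -/
def pksat {W D : Type} (R : W → W → Prop) (Dom : W → Set D)
    (ξ : ℕ → (n : ℕ) → W → (Fin n → D) → Prop) :
    (ℕ → D) → W → PF → Prop
  | _, _, .falsum => False
  | env, u, .pred k n args => ξ k n u (fun i => env (args i))
  | env, u, .impl A B => pksat R Dom ξ env u A → pksat R Dom ξ env u B
  | env, u, .box A => ∀ v, R u v → pksat R Dom ξ env v A
  | env, u, .all x A => ∀ a ∈ Dom u, pksat R Dom ξ (Function.update env x a) u A

/-- satisfaction in a predicate neighbourhood model with constant domain `Dstar`. -/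
def pnsat {X Dstar : Type} (τ : X → Filter X)
    (θ : ℕ → (n : ℕ) → X → (Fin n → Dstar) → Prop) :
    (ℕ → Dstar) → X → PF → Prop
  | _, _, .falsum => False
  | env, x, .pred k n args => θ k n x (fun i => env (args i))
  | env, x, .impl A B => pnsat τ θ env x A → pnsat τ θ env x B
  | env, x, .box A => ∃ U ∈ τ x, ∀ y ∈ U, pnsat τ θ env y A
  | env, x, .all v A => ∀ a : Dstar, pnsat τ θ (Function.update env v a) x A

/-- p-morphism of predicate Kripke frames with expanding domains:
a p-morphism of frames together with a compatible family of surjections between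
the domains (encoded as total maps on the domain carriers). -/
def IsPredKPMorph {W W' D D' : Type} (R : W → W → Prop) (R' : W' → W' → Prop)
    (Dom : W → Set D) (Dom' : W' → Set D')
    (f : W → W') (g : W → D → D') : Prop :=
  IsPMorphismK R R' f ∧
  (∀ w, Set.MapsTo (g w) (Dom w) (Dom' (f w))) ∧
  (∀ w, Set.SurjOn (g w) (Dom w) (Dom' (f w))) ∧
  (∀ w w', R w w' → ∀ d ∈ Dom w, g w d = g w' d)

/-- p-morphism from a predicate neighbourhood frame with constant domain `Dstar`
to a predicate Kripke frame with expanding domains. -/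
def IsPredNPMorph {X W Dstar D : Type} (τ : X → Filter X)
    (R : W → W → Prop) (Dom : W → Set D)
    (f : X → W) (g : X → Dstar → D) : Prop :=
  IsPMorphismN τ (nbhdOf R) f ∧
  (∀ x (d : Dstar), g x d ∈ Dom (f x)) ∧
  (∀ x, ∀ e ∈ Dom (f x), ∃ d : Dstar, g x d = e) ∧
  (∀ (d : Dstar) (x : X), ∃ U ∈ τ x, ∀ y ∈ U, g y d = g x d)

/- ### The map h -/

/-- fuel-driven version of the interleaving map `h`:
a nonzero letter of `γ` is emitted; a zero of `γ` consumes (and emits, unless it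
is a zero) one letter of `α`. -/
def hAux {W A : Type} : ℕ → (ℕ → Option W) → (ℕ → Option A) → List (W ⊕ A)
  | 0, _, _ => []
  | n+1, α, γ =>
    match γ 0 with
    | some c => Sum.inr c :: hAux n α (fun i => γ (i+1))
    | none =>
      match α 0 with
      | some a => Sum.inl a :: hAux n (fun i => α (i+1)) (fun i => γ (i+1))
      | none => hAux n (fun i => α (i+1)) (fun i => γ (i+1))

/-- the map `h : W_ω × ℝ_ω → (W ∪ ℝ∖{0})*`. -/
def hfun {W : Type} {R : W → W → Prop} {w0 : W}
    (α : Wom W R w0) (γ : Wom Rnz TotR y0R) : List (W ⊕ Rnz) :=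
  hAux (stOf α.1 + stOf γ.1) α.1 γ.1

/- ### Normal modal logics -/

def substMF (σ : ℕ → MF) : MF → MF
  | .falsum => .falsum
  | .prop n => σ n
  | .impl A B => .impl (substMF σ A) (substMF σ B)
  | .box A => .box (substMF σ A)

def beval (v : ℕ → Prop) (b : MF → Prop) : MF → Prop
  | .falsum => False
  | .prop n => v n
  | .impl A B => beval v b A → beval v b B
  | .box A => b A

/-- classical propositional tautology (boxed formulas treated as atoms). -/
def TautMF (A : MF) : Prop := ∀ v b, beval v b A

/-- derivability in the minimal normal modal logic with extra axioms `Ax`. -/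
inductive KDer (Ax : Set MF) : MF → Prop
  | ax {A : MF} : A ∈ Ax → KDer Ax A
  | taut {A : MF} : TautMF A → KDer Ax A
  | normality (A B : MF) :
      KDer Ax (.impl (.box (.impl A B)) (.impl (.box A) (.box B)))
  | mp {A B : MF} : KDer Ax (.impl A B) → KDer Ax A → KDer Ax B
  | nec {A : MF} : KDer Ax A → KDer Ax (.box A)
  | subst {A : MF} (σ : ℕ → MF) : KDer Ax A → KDer Ax (substMF σ A)

/-- the axioms `□p → □^k p` for `k ∈ K`. -/
def ptcAxiomSet (K : Set ℕ) : Set MF := {A | ∃ k ∈ K, A = ptcAxiom k}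

/- ### Universal strict Horn sentences -/

/-- quantifier-free positive formulas in the signature of one binary relation. -/
inductive PosF : Type
  | atom : ℕ → ℕ → PosF
  | conj : PosF → PosF → PosF
  | disj : PosF → PosF → PosF

def PosF.sat {V : Type} (S : V → V → Prop) (env : ℕ → V) : PosF → Prop
  | .atom i j => S (env i) (env j)
  | .conj A B => PosF.sat S env A ∧ PosF.sat S env B
  | .disj A B => PosF.sat S env A ∨ PosF.sat S env B

/-- a universal strict Horn sentence `∀ ... (φ → R x y)`. -/
structure Horn : Type where
  hyp : PosF
  cx : ℕ
  cy : ℕ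

def Horn.Holds {V : Type} (φ : Horn) (S : V → V → Prop) : Prop :=
  ∀ env : ℕ → V, PosF.sat S env φ.hyp → S (env φ.cx) (env φ.cy)

/-- the `Γ`-closure `S^Γ`: the least relation containing `S` and validating `Γ`. -/
def hornClosure {V : Type} (Γ : Set Horn) (S : V → V → Prop) : V → V → Prop :=
  fun a b => ∀ T : V → V → Prop,
    (∀ x y, S x y → T x y) → (∀ φ ∈ Γ, φ.Holds T) → T a b

/-- a Horn sentence corresponds to the axiom `□p → □^k p` if it defines exactly the
frames validating that axiom. -/
def Corresponds (φ : Horn) (k : ℕ) : Prop :=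
  ∀ (V : Type) (S : V → V → Prop),
    φ.Holds S ↔ ∀ (Val : ℕ → Set V) (x : V), ksat S Val x (ptcAxiom k)

/-- `U^Γ_k(α)`. -/
def UkG {W : Type} {R : W → W → Prop} {w0 : W} (Γ : Set Horn) (k : ℕ)
    (α : Wom W R w0) : Set (Wom W R w0) :=
  {β | (∀ i, i < max k (stOf α.1) → α.1 i = β.1 i) ∧
        hornClosure Γ (RSharp R w0) (fzero α) (fzero β)}

/-- the neighbourhood function of `N^Γ_ω(F)`. -/
def tauG {W : Type} (R : W → W → Prop) (w0 : W) (Γ : Set Horn)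
    (α : Wom W R w0) : Filter (Wom W R w0) :=
  ⨅ n : ℕ, Filter.principal (UkG Γ n α)

/- ### Quantified modal logic QL -/

/-- substitution of predicate formulas for the letters of a propositional formula. -/
def psubst (σ : ℕ → PF) : MF → PF
  | .falsum => .falsum
  | .prop n => σ n
  | .impl A B => .impl (psubst σ A) (psubst σ B)
  | .box A => .box (psubst σ A)

def FreeIn (x : ℕ) : PF → Prop
  | .falsum => False
  | .pred _ _ args => ∃ i, args i = x
  | .impl A B => FreeIn x A ∨ FreeIn x B
  | .box A => FreeIn x A
  | .all z A => z ≠ x ∧ FreeIn x A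

/-- substitution of variable `y` for the free occurrences of variable `x`. -/
def subV (x y : ℕ) : PF → PF
  | .falsum => .falsum
  | .pred k n args => .pred k n (fun i => if args i = x then y else args i)
  | .impl A B => .impl (subV x y A) (subV x y B)
  | .box A => .box (subV x y A)
  | .all z A => if z = x then .all z A else .all z (subV x y A)

/-- `y` is substitutable for `x` (no capture). -/
def FreeFor (y x : ℕ) : PF → Prop
  | .falsum => True
  | .pred _ _ _ => True
  | .impl A B => FreeFor y x A ∧ FreeFor y x B
  | .box A => FreeFor y x A
  | .all z A => x = z ∨ ((z = y → ¬ FreeIn x A) ∧ FreeFor y x A)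

/-- derivability in the minimal predicate modal logic `QL` over the propositional
logic axiomatized by `Ax`. -/
inductive QLDer (Ax : Set MF) : PF → Prop
  | propInst {A : MF} (σ : ℕ → PF) : KDer Ax A → QLDer Ax (psubst σ A)
  | allElim (x y : ℕ) (A : PF) (h : FreeFor y x A) :
      QLDer Ax (.impl (.all x A) (subV x y A))
  | allShift (x : ℕ) (A B : PF) (h : ¬ FreeIn x B) :
      QLDer Ax (.impl (.all x (.impl B A)) (.impl B (.all x A)))
  | exShift (x : ℕ) (A B : PF) (h : ¬ FreeIn x B) :
      QLDer Ax (.impl (.all x (.impl A B)) (.impl (exPF x A) B))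
  | mp {A B : PF} : QLDer Ax (.impl A B) → QLDer Ax A → QLDer Ax B
  | nec {A : PF} : QLDer Ax A → QLDer Ax (.box A)
  | gen {A : PF} (x : ℕ) : QLDer Ax A → QLDer Ax (.all x A)

/-- a predicate neighbourhood frame with constant domain. -/
structure PredNFrame : Type 1 where
  X : Type
  tau : X → Filter X
  D : Type
  hD : Nonempty D

/-- validity of a predicate formula (i.e. of its universal closure) on a predicate
neighbourhood frame with constant domain. -/
def PredNFrame.Valid (F : PredNFrame) (A : PF) : Prop :=
  ∀ (θ : ℕ → (n : ℕ) → F.X → (Fin n → F.D) → Prop) (env : ℕ → F.D) (x : F.X),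
    pnsat F.tau θ env x A

end

/-- `zf α` may be computed from any prefix beyond which `α` vanishes. -/
theorem zf_eq_filterMap_range {A : Type} {α : ℕ → Option A} {m : ℕ}
    (h : ∀ k, m ≤ k → α k = none) : zf α = (List.range m).filterMap α := by
  have hst : ∀ k, stOf α ≤ k → α k = none :=
    Nat.sInf_mem (s := {m | ∀ k, m ≤ k → α k = none}) ⟨m, h⟩
  obtain ⟨d, rfl⟩ := Nat.exists_eq_add_of_le (show stOf α ≤ m from Nat.sInf_le h)
  rw [List.range_add, List.filterMap_append, List.filterMap_map, zf,
    List.self_eq_append_right, List.filterMap_eq_nil_iff]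
  exact fun k _ => hst _ (Nat.le_add_right _ _)

theorem Wom.eq_none_of_stOf_le {W : Type} {R : W → W → Prop} {w0 : W} (α : Wom W R w0) {k : ℕ}
    (hk : stOf α.1 ≤ k) : α.1 k = none :=
  Nat.sInf_mem (s := {m | ∀ k, m ≤ k → α.1 k = none}) α.2.1 k hk

theorem last_eq_of_eq_append {W : Type} {R : W → W → Prop} {w0 : W} {p q : Unravel W R w0} {v : W}
    (h : q.1 = p.1 ++ [v]) : q.last = v := by
  simp [Unravel.last, h]

/-- Every step of `R` from the last point of `α` is realised inside each `U_n(α)`. -/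
theorem exists_mem_Uk_last_eq {W : Type} {R : W → W → Prop} {w0 : W} (α : Wom W R w0) (n : ℕ)
    {y : W} (hy : R (fzero α).last y) : ∃ β ∈ Uk n α, (fzero β).last = y := by
  let m := max n (stOf α.1)
  let b : ℕ → Option W := fun i => if i < m then α.1 i else if i = m then some y else none
  have hb : ∀ k, m + 1 ≤ k → b k = none := fun k hk => by
    simp [b, show ¬ k < m by omega, show k ≠ m by omega]
  have hα : zf α.1 = (List.range m).filterMap α.1 :=
    zf_eq_filterMap_range fun k hk => α.eq_none_of_stOf_le (le_trans (le_max_right _ _) hk)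
  have hzf : zf b = zf α.1 ++ [y] := by
    rw [zf_eq_filterMap_range hb, List.range_succ, List.filterMap_append, hα]
    congr 1
    · exact List.filterMap_congr fun i hi => by simp [b, List.mem_range.1 hi]
    · simp [b]
  have hchain : List.IsChain R (w0 :: zf b) := by
    rw [hzf, ← List.cons_append]
    refine List.isChain_append.2 ⟨α.2.2, List.isChain_singleton _, ?_⟩
    intro x hx z hz
    obtain rfl : y = z := by simpa using hz
    rw [List.getLast?_eq_some_getLast (List.cons_ne_nil _ _), Option.mem_some_iff] at hx
    exact hx ▸ hy
  let β : Wom W R w0 := ⟨b, ⟨_, hb⟩, hchain⟩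
  have happ : (fzero β).1 = (fzero α).1 ++ [y] := by
    simp [fzero, β, hzf]
  exact ⟨β, ⟨fun i hi => (if_pos hi).symm, y, happ, hy⟩, last_eq_of_eq_append happ⟩

theorem mem_tauOm_iff {W : Type} {R : W → W → Prop} {w0 : W} {α : Wom W R w0}
    {U : Set (Wom W R w0)} : U ∈ tauOm R w0 α ↔ ∃ n, Uk n α ⊆ U := by
  have hanti : Antitone fun n => Uk n α := fun _ _ hmn _ hβ =>
    ⟨fun i hi => hβ.1 i (lt_of_lt_of_le hi (max_le_max_right _ hmn)), hβ.2⟩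
  simpa [tauOm] using (Filter.hasBasis_iInf_principal hanti.directed_ge).mem_iff (t := U)

/-- Taking the last point of `f₀(α)` preserves and reflects truth. -/
theorem nbsat_tauOm_iff_ksat {W : Type} (R : W → W → Prop) (w0 : W) (V : ℕ → Set W) (A : MF)
    (α : Wom W R w0) :
    nbsat (tauOm R w0) (fun n => {β | (fzero β).last ∈ V n}) α A ↔
      ksat R V (fzero α).last A := by
  induction A generalizing α with
  | falsum => rfl
  | prop n => rfl
  | impl A B ihA ihB => simp only [nbsat, ksat, ihA, ihB]
  | box A ih =>
    simp only [nbsat, ksat, ih]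
    constructor
    · rintro ⟨U, hU, hA⟩ y hy
      obtain ⟨n, hn⟩ := mem_tauOm_iff.1 hU
      obtain ⟨β, hβ, rfl⟩ := exists_mem_Uk_last_eq α n hy
      exact hA β (hn hβ)
    · refine fun h => ⟨Uk 0 α, mem_tauOm_iff.2 ⟨0, subset_rfl⟩, ?_⟩
      rintro β ⟨-, v, hv, hR⟩
      rw [last_eq_of_eq_append hv]
      exact h v hR

theorem exists_last_fzero_eq {W : Type} {R : W → W → Prop} {w0 : W} (hroot : IsRootedAt R w0)
    (w : W) : ∃ α : Wom W R w0, (fzero α).last = w := by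
  induction hroot w with
  | refl =>
    have hzf : zf (fun _ => none : ℕ → Option W) = [] :=
      zf_eq_filterMap_range (m := 0) fun _ _ => rfl
    refine ⟨⟨fun _ => none, ⟨0, fun _ _ => rfl⟩, ?_⟩, ?_⟩
    · rw [hzf]
      exact List.isChain_singleton _
    · simp [Unravel.last, fzero, hzf]
  | tail _ hR ih =>
    obtain ⟨α, rfl⟩ := ih
    obtain ⟨β, -, hβ⟩ := exists_mem_Uk_last_eq α 0 hR
    exact ⟨β, hβ⟩

/-- `Log(N_ω(F)) ⊆ Log(F)` for a rooted Kripke frame `F`. -/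
theorem nlog_tauOm_subset_klog {W : Type} (R : W → W → Prop) (w0 : W)
    (hroot : IsRootedAt R w0) :
    NLog (tauOm R w0) ⊆ KLog R := by
  intro A hA V x
  obtain ⟨α, rfl⟩ := exists_last_fzero_eq hroot x
  exact (nbsat_tauOm_iff_ksat R w0 V A α).1 (hA _ α)
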